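/- Let λ₀, λ₁ ∈ Λ_{n,m}. Then at least one of the following statements holds: (1) there is no η ∈ Λ_{n,m} such that the circle diagram \underline{λ₁}η\overline{λ₀} is oriented; (2) there is some η ∈ Λ_{n,m} \ {λ₀, λ₁} such that the circle diagram \underline{λ₁}η\overline{λ₀} is oriented; (3) λ₀ = w_{λ₁} or λ₁ = w_{λ₀}. -/

import Mathlib

open scoped Classical

namespace ArcAlgebra

variable {m : ℕ}

/-- `l : Fin m → Bool` is a weight of type `(n, m)`: positions are `0`-based (position
`a : Fin m` corresponds to the 1-based position `a.val + 1`), the value `true` stands for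
`∨` and `false` for `∧`, and `l` takes the value `∨` exactly `n` times. -/
def IsWeight (n : ℕ) (l : Fin m → Bool) : Prop :=
  (Finset.univ.filter (fun a => l a = true)).card = n

/-- The number of `∨`'s strictly between `c` and `c'` equals the number of `∧`'s strictly
between `c` and `c'`. -/
def Balanced (l : Fin m → Bool) (c c' : Fin m) : Prop :=
  (Finset.univ.filter (fun x => c < x ∧ x < c' ∧ l x = true)).card =
    (Finset.univ.filter (fun x => c < x ∧ x < c' ∧ l x = false)).card

/-- `Matches l c c'` says `c` is a good point of `l` with partner `c^∧ = c'`: one has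
`l c = ∨`, `c < c'`, `l c' = ∧`, the counts of `∨`'s and `∧`'s strictly between `c` and
`c'` balance, and `c'` is minimal with these properties. -/
def Matches (l : Fin m → Bool) (c c' : Fin m) : Prop :=
  l c = true ∧ c < c' ∧ l c' = false ∧ Balanced l c c' ∧
    ∀ d : Fin m, c < d → l d = false → Balanced l c d → c' ≤ d

/-- `c` is a good point of `l`. -/
def IsGood (l : Fin m → Bool) (c : Fin m) : Prop :=
  ∃ c', Matches l c c'

/-- `a` is a ray position of `l`: neither a good point of `l` nor the partner `c^∧` of a
good point `c` of `l`. -/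
def RayPos (l : Fin m → Bool) (a : Fin m) : Prop :=
  ¬ IsGood l a ∧ ¬ ∃ c, Matches l c a

/-- `η` orients the diagram of `l`: `η(c) ≠ η(c^∧)` for every good point `c` of `l`, and
whenever `a < b` are ray positions of `l` with `η a = ∨`, also `η b = ∨`. -/
def Orients (η l : Fin m → Bool) : Prop :=
  (∀ c c', Matches l c c' → η c ≠ η c') ∧
    ∀ a b, RayPos l a → RayPos l b → a < b → η a = true → η b = true

/-- The number of good points of `l`. -/
noncomputable def goodCount (l : Fin m → Bool) : ℕ :=
  (Finset.univ.filter (fun c => IsGood l c)).card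

/-- The weight `w_l`: it takes the value `∨` exactly at the partners `c^∧` of the good
points `c` of `l` and at the `n − goodCount l` largest ray positions of `l` (a ray position
`a` is among the `k` largest ray positions iff fewer than `k` ray positions exceed it). -/
noncomputable def wMax (n : ℕ) (l : Fin m → Bool) : Fin m → Bool := fun a =>
  if (∃ c, Matches l c a) ∨
      (RayPos l a ∧
        (Finset.univ.filter (fun b => RayPos l b ∧ a < b)).card < n - goodCount l)
  then true else false

/-- The Bruhat order on weights: `l ≤ μ` iff there is a bijection `f` from `l⁻¹(∨)` to
`μ⁻¹(∨)` with `x ≤ f x` for all `x`. -/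
def BruhatLE (l μ : Fin m → Bool) : Prop :=
  ∃ f : {x : Fin m // l x = true} → {y : Fin m // μ y = true},
    Function.Bijective f ∧ ∀ x, x.1 ≤ (f x).1

end ArcAlgebra

namespace ArcAlgebra

variable {m : ℕ}

/-- The number of positions `x < k` at which `l` takes the value `b`. -/
noncomputable def prefixCount (l : Fin m → Bool) (b : Bool) (k : ℕ) : ℕ :=
  (Finset.univ.filter (fun x : Fin m => x.val < k ∧ l x = b)).card

/-- The number of `∨`'s minus the number of `∧`'s among the positions `x < k` of `l`. -/
noncomputable def height (l : Fin m → Bool) (k : ℕ) : ℤ :=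
  prefixCount l true k - prefixCount l false k

lemma prefixCount_succ (l : Fin m → Bool) (b : Bool) (x : Fin m) :
    prefixCount l b (x.val + 1) = prefixCount l b x.val + if l x = b then 1 else 0 := by
  unfold prefixCount
  split_ifs with h
  · rw [← Finset.card_insert_of_notMem (a := x) (by simp)]
    congr 1
    ext y
    simp only [Finset.mem_filter, Finset.mem_univ, true_and, Finset.mem_insert]
    constructor
    · rintro ⟨h1, h2⟩
      rcases Nat.lt_succ_iff_lt_or_eq.mp h1 with h3 | h3
      · exact Or.inr ⟨h3, h2⟩
      · exact Or.inl (Fin.ext h3)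
    · rintro (rfl | ⟨h1, h2⟩)
      · exact ⟨Nat.lt_succ_self _, h⟩
      · exact ⟨by omega, h2⟩
  · rw [add_zero]
    congr 1
    ext y
    simp only [Finset.mem_filter, Finset.mem_univ, true_and]
    constructor
    · rintro ⟨h1, h2⟩
      refine ⟨?_, h2⟩
      rcases Nat.lt_succ_iff_lt_or_eq.mp h1 with h3 | h3
      · exact h3
      · exact absurd (Fin.ext h3 ▸ h2) h
    · rintro ⟨h1, h2⟩
      exact ⟨by omega, h2⟩

lemma height_succ_of_true {l : Fin m → Bool} {x : Fin m} (h : l x = true) :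
    height l (x.val + 1) = height l x.val + 1 := by
  simp only [height, prefixCount_succ, h]
  simp
  ring

lemma height_succ_of_false {l : Fin m → Bool} {x : Fin m} (h : l x = false) :
    height l (x.val + 1) = height l x.val - 1 := by
  simp only [height, prefixCount_succ, h]
  simp
  ring

lemma prefixCount_add_between (l : Fin m → Bool) (b : Bool) {c d : Fin m} (h : c < d) :
    prefixCount l b d.val = prefixCount l b (c.val + 1) +
      (Finset.univ.filter (fun x => c < x ∧ x < d ∧ l x = b)).card := by
  unfold prefixCount
  rw [← Finset.card_union_of_disjoint]
  · congr 1
    ext y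
    simp only [Finset.mem_filter, Finset.mem_univ, true_and, Finset.mem_union, Fin.lt_def] at h ⊢
    by_cases hy : l y = b <;> simp only [hy, and_true, and_false, or_false]
    omega
  · rw [Finset.disjoint_left]
    intro y
    simp only [Finset.mem_filter, Finset.mem_univ, true_and, Fin.lt_def]
    omega

lemma balanced_iff_height {l : Fin m → Bool} {c d : Fin m} (h : c < d) :
    Balanced l c d ↔ height l d.val = height l (c.val + 1) := by
  have h1 := prefixCount_add_between l true h
  have h2 := prefixCount_add_between l false h
  unfold Balanced height
  omega

/-- `c` and `c'` are matched when the height first returns to its value before `c` right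
after `c'`. -/
lemma matches_iff_height {l : Fin m → Bool} {c d : Fin m} :
    Matches l c d ↔ c < d ∧ height l (d.val + 1) = height l c.val ∧
      ∀ k, c.val < k → k ≤ d.val → height l c.val < height l k := by
  constructor
  · rintro ⟨hc, hcd, hd, hb, hmin⟩
    have h1 := height_succ_of_true hc
    have h2 := height_succ_of_false hd
    rw [balanced_iff_height hcd] at hb
    refine ⟨hcd, by omega, ?_⟩
    intro k
    induction k with
    | zero => intro h; omega
    | succ k ih =>
      intro hck hkd
      rcases Nat.lt_succ_iff_lt_or_eq.mp hck with h3 | h3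
      · have ih := ih h3 (by omega)
        let x : Fin m := ⟨k, by omega⟩
        cases hx : l x with
        | true =>
          have := height_succ_of_true hx
          simp only [x] at this
          omega
        | false =>
          have h4 := height_succ_of_false hx
          simp only [x] at h4
          by_contra hcon
          have hcx : c < x := h3
          have := hmin x hcx hx ((balanced_iff_height hcx).2 (by simp only [x]; omega))
          rw [Fin.le_def] at this
          simp only [x] at this
          omega
      · rw [← h3]; omega
  · rintro ⟨hcd, he, hpos⟩
    have hcd' : c.val < d.val := hcd
    have hc : l c = true := by
      by_contra hc
      have := height_succ_of_false (Bool.eq_false_iff.2 hc)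
      have := hpos (c.val + 1) (by omega) (by omega)
      omega
    have hd : l d = false := by
      by_contra hd
      have := height_succ_of_true (Bool.eq_true_of_not_eq_false hd)
      have := hpos d.val hcd' le_rfl
      omega
    have h1 := height_succ_of_true hc
    have h2 := height_succ_of_false hd
    refine ⟨hc, hcd, hd, (balanced_iff_height hcd).2 (by omega), ?_⟩
    intro e hce he' hbe
    rw [balanced_iff_height hce] at hbe
    have h3 := height_succ_of_false he'
    by_contra hcon
    have hed : e.val < d.val := not_le.1 hcon
    have hce' : c.val < e.val := hce
    have := hpos (e.val + 1) (by omega) (by omega)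
    omega

lemma Matches.right_unique {l : Fin m → Bool} {c d e : Fin m} (h : Matches l c d)
    (h' : Matches l c e) : d = e :=
  le_antisymm (h.2.2.2.2 e h'.2.1 h'.2.2.1 h'.2.2.2.1)
    (h'.2.2.2.2 d h.2.1 h.2.2.1 h.2.2.2.1)

lemma Matches.left_unique {l : Fin m → Bool} {c d e : Fin m} (h : Matches l c e)
    (h' : Matches l d e) : c = d := by
  obtain ⟨h1, h2, h3⟩ := matches_iff_height.1 h
  obtain ⟨h1', h2', h3'⟩ := matches_iff_height.1 h'
  rw [Fin.lt_def] at h1 h1'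
  rcases lt_trichotomy c.val d.val with h4 | h4 | h4
  · have := h3 d.val h4 h1'.le
    omega
  · exact Fin.ext h4
  · have := h3' c.val h4 h1.le
    omega

lemma exists_matches_of_height_le {l : Fin m → Bool} {c : Fin m} (hc : l c = true) {k : ℕ}
    (hck : c.val < k) (hkm : k ≤ m) (hk : height l k ≤ height l c.val) :
    ∃ d : Fin m, d.val < k ∧ Matches l c d := by
  have hex : ∃ j, c.val < j ∧ height l j ≤ height l c.val := ⟨k, hck, hk⟩
  obtain ⟨h1, h2⟩ := Nat.find_spec hex
  have hmin : ∀ j, c.val < j → j < Nat.find hex → height l c.val < height l j := by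
    intro j hj hj'
    have := Nat.find_min hex hj'
    by_contra hcon
    exact this ⟨hj, not_lt.1 hcon⟩
  have hle : Nat.find hex ≤ k := Nat.find_min' hex ⟨hck, hk⟩
  generalize Nat.find hex = j at *
  have h3 := height_succ_of_true hc
  have hj : j ≠ c.val + 1 := by rintro rfl; omega
  obtain ⟨i, rfl⟩ : ∃ i, j = i + 1 := ⟨j - 1, by omega⟩
  have h4 := hmin i (by omega) (by omega)
  let d : Fin m := ⟨i, by omega⟩
  have hd : height l (d.val + 1) = height l c.val := by
    cases hx : l d with
    | true =>
      have := height_succ_of_true hx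
      simp only [d] at this ⊢
      omega
    | false =>
      have := height_succ_of_false hx
      simp only [d] at this ⊢
      omega
  refine ⟨d, hle, matches_iff_height.2 ⟨?_, hd, ?_⟩⟩
  · rw [Fin.lt_def]; simp only [d]; omega
  · intro k' hk' hk''
    exact hmin k' hk' (by simp only [d] at hk''; omega)

lemma exists_matches_of_le_height {l : Fin m → Bool} {d : Fin m} (hd : l d = false) {k : ℕ}
    (hkd : k ≤ d.val) (hk : height l k ≤ height l (d.val + 1)) :
    ∃ c : Fin m, k ≤ c.val ∧ Matches l c d := by
  have h2 := Nat.findGreatest_spec (P := fun j => height l j ≤ height l (d.val + 1)) hkd hk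
  have hmax : ∀ j, Nat.findGreatest (fun j => height l j ≤ height l (d.val + 1)) d.val < j →
      j ≤ d.val → height l (d.val + 1) < height l j := by
    intro j hj hj'
    exact not_le.1 (Nat.findGreatest_is_greatest hj hj')
  have hle := Nat.le_findGreatest (P := fun j => height l j ≤ height l (d.val + 1)) hkd hk
  have hle' := Nat.findGreatest_le (P := fun j => height l j ≤ height l (d.val + 1)) d.val
  generalize Nat.findGreatest (fun j => height l j ≤ height l (d.val + 1)) d.val = j at *
  have h3 := height_succ_of_false hd
  have hj : j ≠ d.val := by rintro rfl; omega
  have h4 := hmax (j + 1) (by omega) (by omega)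
  let c : Fin m := ⟨j, by omega⟩
  have hc : height l (d.val + 1) = height l c.val := by
    cases hx : l c with
    | true =>
      have := height_succ_of_true hx
      simp only [c] at this ⊢
      omega
    | false =>
      have := height_succ_of_false hx
      simp only [c] at this ⊢
      omega
  refine ⟨c, hle, matches_iff_height.2 ⟨?_, hc, ?_⟩⟩
  · rw [Fin.lt_def]; simp only [c]; omega
  · intro k' hk' hk''
    rw [← hc]
    exact hmax k' hk' hk''

/-- Every weight orients its own diagram. -/
lemma orients_self (l : Fin m → Bool) : Orients l l := by
  refine ⟨fun c d h => by rw [h.1, h.2.2.1]; decide, ?_⟩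
  intro a b ha hb hab hla
  by_contra hlb
  have hlb := Bool.eq_false_iff.2 hlb
  rw [Fin.lt_def] at hab
  by_cases h : height l (b.val + 1) ≤ height l a.val
  · obtain ⟨d, -, hd⟩ := exists_matches_of_height_le hla (by omega) b.isLt h
    exact ha.1 ⟨d, hd⟩
  · obtain ⟨c, -, hc⟩ := exists_matches_of_le_height hlb hab.le (not_le.1 h).le
    exact hb.2 ⟨c, hc⟩

lemma card_true_eq_goodCount_add {η l : Fin m → Bool} (h : ∀ c d, Matches l c d → η c ≠ η d) :
    (Finset.univ.filter (fun a => η a = true)).card =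
      goodCount l + (Finset.univ.filter (fun a => RayPos l a ∧ η a = true)).card := by
  have hbij : (Finset.univ.filter (fun a => (∃ c, Matches l c a) ∧ η a = true)).card =
      (Finset.univ.filter (fun a => IsGood l a ∧ ¬ η a = true)).card := by
    symm
    refine Finset.card_bij (fun a ha => (Finset.mem_filter.1 ha).2.1.choose) ?_ ?_ ?_
    · intro a ha
      have h1 := (Finset.mem_filter.1 ha).2.1.choose_spec
      have h2 := (Finset.mem_filter.1 ha).2.2
      have h3 := h _ _ h1
      refine Finset.mem_filter.2 ⟨Finset.mem_univ _, ⟨a, h1⟩, ?_⟩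
      exact Bool.eq_true_of_not_eq_false fun hcon =>
        h3 ((Bool.eq_false_iff.2 h2).trans hcon.symm)
    · intro a ha b hb hab
      have h1 := (Finset.mem_filter.1 ha).2.1.choose_spec
      have h2 := (Finset.mem_filter.1 hb).2.1.choose_spec
      rw [hab] at h1
      exact h1.left_unique h2
    · intro b hb
      obtain ⟨-, ⟨c, hc⟩, hb'⟩ := Finset.mem_filter.1 hb
      have hcf : ¬ η c = true := fun hcon => h c b hc (hcon.trans hb'.symm)
      have hmem : c ∈ Finset.univ.filter (fun a => IsGood l a ∧ ¬ η a = true) :=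
        Finset.mem_filter.2 ⟨Finset.mem_univ _, ⟨b, hc⟩, hcf⟩
      exact ⟨c, hmem, (Finset.mem_filter.1 hmem).2.1.choose_spec.right_unique hc⟩
  have hgood : goodCount l = (Finset.univ.filter (fun a => IsGood l a ∧ η a = true)).card +
      (Finset.univ.filter (fun a => IsGood l a ∧ ¬ η a = true)).card := by
    unfold goodCount
    rw [← Finset.card_filter_add_card_filter_not (s := Finset.univ.filter (fun c => IsGood l c))
      (fun a => η a = true), Finset.filter_filter, Finset.filter_filter]
  rw [hgood, ← hbij, ← Finset.card_union_of_disjoint, ← Finset.card_union_of_disjoint]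
  · congr 1
    ext a
    simp only [Finset.mem_filter, Finset.mem_univ, true_and, Finset.mem_union]
    unfold RayPos
    tauto
  · rw [Finset.disjoint_left]
    intro a
    simp only [Finset.mem_filter, Finset.mem_univ, true_and, Finset.mem_union]
    unfold RayPos
    tauto
  · rw [Finset.disjoint_left]
    intro a
    simp only [Finset.mem_filter, Finset.mem_univ, true_and]
    rintro ⟨⟨d, hd⟩, -⟩ ⟨⟨c, hc⟩, -⟩
    have := hd.1
    rw [hc.2.2.1] at this
    exact absurd this (by decide)

lemma Orients.ray_eq_true_iff {n : ℕ} {η l : Fin m → Bool} (h : Orients η l)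
    (hη : IsWeight n η) {a : Fin m} (ha : RayPos l a) :
    η a = true ↔
      (Finset.univ.filter (fun b => RayPos l b ∧ a < b)).card < n - goodCount l := by
  have hcard := card_true_eq_goodCount_add h.1
  unfold IsWeight at hη
  rw [hη] at hcard
  rw [show n - goodCount l = (Finset.univ.filter (fun a => RayPos l a ∧ η a = true)).card by omega]
  constructor
  · intro hηa
    apply Finset.card_lt_card
    rw [Finset.ssubset_iff_of_subset]
    · exact ⟨a, by simp [ha, hηa], by simp⟩
    · intro b
      simp only [Finset.mem_filter, Finset.mem_univ, true_and]
      rintro ⟨hb, hab⟩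
      exact ⟨hb, h.2 a b ha hb hab hηa⟩
  · intro hlt
    by_contra hηa
    refine absurd hlt (not_lt.2 (Finset.card_le_card ?_))
    intro b
    simp only [Finset.mem_filter, Finset.mem_univ, true_and]
    rintro ⟨hb, hηb⟩
    refine ⟨hb, ?_⟩
    rcases lt_trichotomy a b with hab | rfl | hab
    · exact hab
    · exact absurd hηb hηa
    · exact absurd (h.2 b a hb ha hab hηb) hηa

lemma Orients.ray_eq {n : ℕ} {η l : Fin m → Bool} (h : Orients η l)
    (hη : IsWeight n η) (hl : IsWeight n l) {a : Fin m} (ha : RayPos l a) : η a = l a := by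
  rw [Bool.eq_iff_iff, h.ray_eq_true_iff hη ha, (orients_self l).ray_eq_true_iff hl ha]

lemma Orients.eq_wMax {n : ℕ} {η l : Fin m → Bool} (h : Orients η l) (hη : IsWeight n η)
    (hcup : ∀ c d, Matches l c d → η c = false) : η = wMax n l := by
  funext a
  rw [Bool.eq_iff_iff]
  by_cases hp : ∃ c, Matches l c a
  · obtain ⟨c, hc⟩ := hp
    have h1 := h.1 c a hc
    rw [hcup c a hc] at h1
    simp only [wMax, show ∃ c, Matches l c a from ⟨c, hc⟩, true_or, if_true, iff_true]
    exact Bool.eq_true_of_not_eq_false h1.symm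
  · by_cases hg : IsGood l a
    · obtain ⟨d, hd⟩ := hg
      have hr : ¬ RayPos l a := fun hr => hr.1 ⟨d, hd⟩
      simp [wMax, hp, hr, hcup a d hd]
    · have hr : RayPos l a := ⟨hg, hp⟩
      rw [h.ray_eq_true_iff hη hr]
      simp [wMax, hp, hr]

/-- At the first position where an orientation of the diagram of `l` differs from `l`, the
weight `l` takes the value `∨`. -/
lemma Orients.eq_true_of_first_ne {n : ℕ} {η l : Fin m → Bool} (h : Orients η l)
    (hη : IsWeight n η) (hl : IsWeight n l) {x : Fin m} (hx : η x ≠ l x)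
    (hmin : ∀ y < x, η y = l y) : l x = true := by
  by_contra hlx
  have hlx := Bool.eq_false_iff.2 hlx
  have hp : ∃ c, Matches l c x := by
    by_contra hp
    refine hx (h.ray_eq hη hl ⟨?_, hp⟩)
    rintro ⟨d, hd⟩
    exact absurd (hd.1.symm.trans hlx) (by decide)
  obtain ⟨c, hc⟩ := hp
  have h1 := h.1 c x hc
  rw [hmin c hc.2.1, hc.1] at h1
  rw [hlx] at hx
  exact h1 (Bool.eq_true_of_not_eq_false hx).symm

lemma Orients.antisymm {n : ℕ} {l l' : Fin m → Bool} (h : Orients l l') (h' : Orients l' l)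
    (hl : IsWeight n l) (hl' : IsWeight n l') : l = l' := by
  by_contra hne
  have hex : ∃ x, l x ≠ l' x := Function.ne_iff.1 hne
  obtain ⟨x, hx, hmin⟩ := WellFounded.has_min (wellFounded_lt (α := Fin m)) {x | l x ≠ l' x} hex
  have hmin' : ∀ y < x, l y = l' y := fun y hy => by
    by_contra hcon
    exact hmin y hcon hy
  have h1 := h.eq_true_of_first_ne hl hl' hx hmin'
  have h2 := h'.eq_true_of_first_ne hl' hl (Ne.symm hx) (fun y hy => (hmin' y hy).symm)
  exact hx (h2.trans h1.symm)

/-- The weight obtained from `l` by exchanging `∨` and `∧` on the set `S`. -/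
noncomputable def flipOn (S : Set (Fin m)) (l : Fin m → Bool) : Fin m → Bool := fun x =>
  if x ∈ S then !l x else l x

/-- A set of positions of the diagram of `l` which is a union of arcs. -/
structure IsArcUnion (l : Fin m → Bool) (S : Set (Fin m)) : Prop where
  mem_iff : ∀ c d, Matches l c d → (c ∈ S ↔ d ∈ S)
  not_rayPos : ∀ a ∈ S, ¬ RayPos l a

lemma IsArcUnion.orients_flipOn {l η : Fin m → Bool} {S : Set (Fin m)} (hS : IsArcUnion l S)
    (h : Orients η l) : Orients (flipOn S η) l := by
  constructor
  · intro c d hcd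
    have h1 := h.1 c d hcd
    have h2 := hS.mem_iff c d hcd
    unfold flipOn
    by_cases hc : c ∈ S
    · simpa [hc, h2.1 hc] using h1
    · simpa [hc, show d ∉ S from fun hd => hc (h2.2 hd)] using h1
  · intro a b ha hb hab
    have ha' : a ∉ S := fun hcon => hS.not_rayPos a hcon ha
    have hb' : b ∉ S := fun hcon => hS.not_rayPos b hcon hb
    simpa [flipOn, ha', hb'] using h.2 a b ha hb hab

lemma IsArcUnion.isWeight_flipOn {n : ℕ} {l η : Fin m → Bool} {S : Set (Fin m)}
    (hS : IsArcUnion l S) (h : Orients η l) (hη : IsWeight n η) : IsWeight n (flipOn S η) := by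
  unfold IsWeight at hη ⊢
  rw [← hη, card_true_eq_goodCount_add h.1, card_true_eq_goodCount_add (hS.orients_flipOn h).1]
  congr 2
  ext a
  simp only [Finset.mem_filter, Finset.mem_univ, true_and]
  refine and_congr_right fun ha => ?_
  have ha' : a ∉ S := fun hcon => hS.not_rayPos a hcon ha
  simp [flipOn, ha']

/-- The end points of the arc from `c` to `c'` and of the arcs directly below it. -/
def outerCircle (l : Fin m → Bool) (c c' : Fin m) : Set (Fin m) :=
  {y | (c.val ≤ y.val ∧ y.val < c'.val ∧ height l (y.val + 1) = height l c.val + 1) ∨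
    (c.val < y.val ∧ y.val ≤ c'.val ∧ height l y.val = height l c.val + 1)}

lemma Matches.exists_matches_of_between {l : Fin m → Bool} {c c' x : Fin m}
    (h : Matches l c c') (hcx : c < x) (hxc : x < c') :
    (∃ y, Matches l x y) ∨ ∃ y, c < y ∧ Matches l y x := by
  obtain ⟨h1, h2, h3⟩ := matches_iff_height.1 h
  rw [Fin.lt_def] at hcx hxc h1
  cases hx : l x with
  | true =>
    have h4 := h3 x.val hcx hxc.le
    obtain ⟨d, -, hd⟩ := exists_matches_of_height_le hx (k := c'.val + 1) (by omega)
      c'.isLt (by omega)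
    exact Or.inl ⟨d, hd⟩
  | false =>
    have h4 := h3 (x.val + 1) (by omega) (by omega)
    obtain ⟨d, hd', hd⟩ := exists_matches_of_le_height hx hcx.le (by omega)
    refine Or.inr ⟨d, lt_of_le_of_ne hd' ?_, hd⟩
    rintro rfl
    exact hxc.ne (congrArg Fin.val (hd.right_unique h))

lemma Matches.isArcUnion_outerCircle {l : Fin m → Bool} {c c' : Fin m} (h : Matches l c c') :
    IsArcUnion l (outerCircle l c c') := by
  obtain ⟨h1, h2, h3⟩ := matches_iff_height.1 h
  rw [Fin.lt_def] at h1
  have h4 := height_succ_of_true h.1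
  have h5 := height_succ_of_false h.2.2.1
  refine ⟨?_, ?_⟩
  · intro a b hab
    obtain ⟨k1, k2, k3⟩ := matches_iff_height.1 hab
    rw [Fin.lt_def] at k1
    have k4 := height_succ_of_true hab.1
    have k5 := height_succ_of_false hab.2.2.1
    by_cases hac : a = c
    · subst hac
      have hb := hab.right_unique h
      subst hb
      exact iff_of_true (Or.inl ⟨le_rfl, h1, h4⟩) (Or.inr ⟨h1, le_rfl, by omega⟩)
    have hbc : b ≠ c' := fun hbc => hac ((hbc ▸ hab).left_unique h)
    have hac' : a.val ≠ c.val := fun hcon => hac (Fin.ext hcon)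
    have hbc' : b.val ≠ c'.val := fun hcon => hbc (Fin.ext hcon)
    have hac2 : a.val ≠ c'.val := fun hcon => by
      have := hab.1
      rw [Fin.ext hcon, h.2.2.1] at this
      exact absurd this (by decide)
    have hbc2 : b.val ≠ c.val := fun hcon => by
      have := hab.2.2.1
      rw [Fin.ext hcon, h.1] at this
      exact absurd this (by decide)
    simp only [outerCircle, Set.mem_ofPred_eq]
    constructor
    · intro ha
      have i1 : c.val < a.val ∧ a.val < c'.val := by omega
      have i2 := h3 a.val i1.1 i1.2.le
      have i3 : b.val < c'.val := by
        by_contra hcon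
        have := k3 (c'.val + 1) (by omega) (by omega)
        omega
      omega
    · intro hb
      have i1 : c.val < b.val ∧ b.val < c'.val := by omega
      have i2 := h3 (b.val + 1) (by omega) (by omega)
      have i3 : c.val < a.val := by
        by_contra hcon
        have := k3 c.val (by omega) (by omega)
        omega
      omega
  · intro a ha hr
    simp only [outerCircle, Set.mem_ofPred_eq] at ha
    by_cases hac : a = c
    · exact hr.1 (hac ▸ ⟨c', h⟩)
    by_cases hac' : a = c'
    · exact hr.2 (hac' ▸ ⟨c, h⟩)
    have i1 : a.val ≠ c.val := fun hcon => hac (Fin.ext hcon)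
    have i2 : a.val ≠ c'.val := fun hcon => hac' (Fin.ext hcon)
    rcases h.exists_matches_of_between (x := a) (by rw [Fin.lt_def]; omega)
      (by rw [Fin.lt_def]; omega) with ⟨y, hy⟩ | ⟨y, -, hy⟩
    · exact hr.1 ⟨y, hy⟩
    · exact hr.2 ⟨y, hy⟩

lemma matches_of_adjacent {l : Fin m → Bool} {x y : Fin m} (hxy : y.val = x.val + 1)
    (hx : l x = true) (hy : l y = false) : Matches l x y := by
  have h1 := height_succ_of_true hx
  have h2 := height_succ_of_false hy
  refine matches_iff_height.2 ⟨by rw [Fin.lt_def]; omega, by rw [hxy] at h2 ⊢; omega, ?_⟩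
  intro k hk hk'
  obtain rfl : k = x.val + 1 := by omega
  omega

/-- If `η` agrees with `l` at the arc from `c` to `c'` but is opposite to `l` strictly below
it, then the arcs of `η` join the neighbouring end points of the arcs directly below. -/
lemma Matches.isArcUnion_outerCircle_of_opposite {l η : Fin m → Bool} {c c' : Fin m}
    (h : Matches l c c') (hc : η c = true) (hc' : η c' = false)
    (hopp : ∀ x, c < x → x < c' → η x = !l x) : IsArcUnion η (outerCircle l c c') := by
  obtain ⟨h1, h2, h3⟩ := matches_iff_height.1 h
  rw [Fin.lt_def] at h1
  have h4 := height_succ_of_true h.1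
  have h5 := height_succ_of_false h.2.2.1
  have hleft : ∀ x : Fin m, c.val ≤ x.val → x.val < c'.val →
      height l (x.val + 1) = height l c.val + 1 → η x = true := by
    intro x hx hx' hh
    by_cases hxc : x = c
    · rw [hxc, hc]
    have hlt : c.val < x.val := lt_of_le_of_ne hx fun hcon => hxc (Fin.ext hcon.symm)
    rw [hopp x hlt hx']
    cases hlx : l x with
    | true =>
      have := height_succ_of_true hlx
      have := h3 x.val hlt hx'.le
      omega
    | false => rfl
  have hright : ∀ x : Fin m, c.val < x.val → x.val ≤ c'.val →
      height l x.val = height l c.val + 1 → η x = false := by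
    intro x hx hx' hh
    by_cases hxc : x = c'
    · rw [hxc, hc']
    have hlt : x.val < c'.val := lt_of_le_of_ne hx' fun hcon => hxc (Fin.ext hcon)
    rw [hopp x hx hlt]
    cases hlx : l x with
    | true => rfl
    | false =>
      have := height_succ_of_false hlx
      have := h3 (x.val + 1) (by omega) (by omega)
      omega
  have hnext : ∀ x : Fin m, c.val ≤ x.val → x.val < c'.val →
      height l (x.val + 1) = height l c.val + 1 →
      ∃ y ∈ outerCircle l c c', Matches η x y := by
    intro x hx hx' hh
    let y : Fin m := ⟨x.val + 1, by omega⟩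
    refine ⟨y, Or.inr ⟨Nat.lt_succ_of_le hx, hx', hh⟩, matches_of_adjacent rfl
      (hleft x hx hx' hh) (hright y (Nat.lt_succ_of_le hx) hx' hh)⟩
  have hprev : ∀ y : Fin m, c.val < y.val → y.val ≤ c'.val →
      height l y.val = height l c.val + 1 →
      ∃ x ∈ outerCircle l c c', Matches η x y := by
    intro y hy hy' hh
    let x : Fin m := ⟨y.val - 1, by omega⟩
    have hxy : y.val = x.val + 1 := by simp only [x]; omega
    have i1 : c.val ≤ x.val := by omega
    have i2 : x.val < c'.val := by omega
    have i3 : height l (x.val + 1) = height l c.val + 1 := by rw [← hxy, hh]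
    exact ⟨x, Or.inl ⟨i1, i2, i3⟩, matches_of_adjacent hxy (hleft x i1 i2 i3)
      (hright y hy hy' hh)⟩
  refine ⟨?_, ?_⟩
  · intro a b hab
    constructor
    · rintro (⟨i1, i2, i3⟩ | ⟨i1, i2, i3⟩)
      · obtain ⟨y, hy, hm⟩ := hnext a i1 i2 i3
        exact hm.right_unique hab ▸ hy
      · exact absurd (hab.1.symm.trans (hright a i1 i2 i3)) (by decide)
    · rintro (⟨i1, i2, i3⟩ | ⟨i1, i2, i3⟩)
      · exact absurd (hab.2.2.1.symm.trans (hleft b i1 i2 i3)) (by decide)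
      · obtain ⟨x, hx, hm⟩ := hprev b i1 i2 i3
        exact hm.left_unique hab ▸ hx
  · rintro a (⟨i1, i2, i3⟩ | ⟨i1, i2, i3⟩) hr
    · obtain ⟨y, -, hm⟩ := hnext a i1 i2 i3
      exact hr.1 ⟨y, hm⟩
    · obtain ⟨x, -, hm⟩ := hprev a i1 i2 i3
      exact hr.2 ⟨x, hm⟩

lemma Orients.exists_ne_of_ne_wMax {n : ℕ} {l η : Fin m → Bool} (h : Orients η l)
    (hη : IsWeight n η) (hl : IsWeight n l) (hne : η ≠ wMax n l) :
    ∃ μ : Fin m → Bool, IsWeight n μ ∧ μ ≠ η ∧ μ ≠ l ∧ Orients μ l ∧ Orients μ η := by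
  have hex : ∃ c, ∃ d, Matches l c d ∧ η c = true := by
    by_contra hcon
    push Not at hcon
    exact hne (h.eq_wMax hη fun c d hcd => Bool.eq_false_iff.2 (hcon c d hcd))
  obtain ⟨c, ⟨c', hcc', hc⟩, hmax⟩ := WellFounded.has_min (wellFounded_gt (α := Fin m))
    {c | ∃ d, Matches l c d ∧ η c = true} hex
  have hinner : ∀ a b, c < a → Matches l a b → η a = false := fun a b hca hab =>
    Bool.eq_false_iff.2 fun hcon => hmax a ⟨b, hab, hcon⟩ hca
  have hc' : η c' = false := Bool.eq_false_iff.2 fun hcon => h.1 c c' hcc' (hc.trans hcon.symm)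
  have hopp : ∀ x, c < x → x < c' → η x = !l x := by
    intro x hcx hxc
    rcases hcc'.exists_matches_of_between hcx hxc with ⟨y, hy⟩ | ⟨y, hcy, hy⟩
    · rw [hinner x y hcx hy, hy.1, Bool.not_true]
    · have h1 := h.1 y x hy
      rw [hinner y x hcy hy] at h1
      rw [hy.2.2.1, Bool.not_false]
      exact Bool.eq_true_of_not_eq_false h1.symm
  have hSl := hcc'.isArcUnion_outerCircle
  have hSη := hcc'.isArcUnion_outerCircle_of_opposite hc hc' hopp
  have hμη : flipOn (outerCircle l c c') η ≠ η := by
    intro hcon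
    have h1 := congrFun hcon c
    have h2 : c ∈ outerCircle l c c' :=
      Or.inl ⟨le_rfl, hcc'.2.1, height_succ_of_true hcc'.1⟩
    simp [flipOn, h2] at h1
  have hoη := hSη.orients_flipOn (orients_self η)
  refine ⟨_, hSl.isWeight_flipOn h hη, hμη, ?_, hSl.orients_flipOn h, hoη⟩
  intro hcon
  rw [hcon] at hoη hμη
  exact hμη (hoη.antisymm h hl hη)

end ArcAlgebra

open ArcAlgebra

/-- Let `λ₀, λ₁ ∈ Λ_{n,m}`.  Then at least one of the following holds:
(1) there is no `η ∈ Λ_{n,m}` such that the circle diagram `\underline{λ₁}η\overline{λ₀}`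
is oriented; (2) there is some `η ∈ Λ_{n,m} \ {λ₀, λ₁}` such that
`\underline{λ₁}η\overline{λ₀}` is oriented; (3) `λ₀ = w_{λ₁}` or `λ₁ = w_{λ₀}`. -/
theorem statement13 (n m : ℕ) (l₀ l₁ : Fin m → Bool)
    (h₀ : IsWeight n l₀) (h₁ : IsWeight n l₁) :
    (¬ ∃ η : Fin m → Bool, IsWeight n η ∧ Orients η l₁ ∧ Orients η l₀) ∨
    (∃ η : Fin m → Bool, IsWeight n η ∧ η ≠ l₀ ∧ η ≠ l₁ ∧
      Orients η l₁ ∧ Orients η l₀) ∨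
    (l₀ = wMax n l₁ ∨ l₁ = wMax n l₀) := by
  by_cases hex : ∃ η : Fin m → Bool, IsWeight n η ∧ Orients η l₁ ∧ Orients η l₀
  swap
  · exact Or.inl hex
  refine Or.inr ?_
  obtain ⟨η, hη, hη₁, hη₀⟩ := hex
  by_cases e₀ : η = l₀
  · subst e₀
    by_cases hw : η = wMax n l₁
    · exact Or.inr (Or.inl hw)
    · obtain ⟨μ, hμ, hne, hne', ho, ho'⟩ := hη₁.exists_ne_of_ne_wMax hη h₁ hw
      exact Or.inl ⟨μ, hμ, hne, hne', ho, ho'⟩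
  by_cases e₁ : η = l₁
  · subst e₁
    by_cases hw : η = wMax n l₀
    · exact Or.inr (Or.inr hw)
    · obtain ⟨μ, hμ, hne, hne', ho, ho'⟩ := hη₀.exists_ne_of_ne_wMax hη h₀ hw
      exact Or.inl ⟨μ, hμ, hne', hne, ho', ho⟩
  exact Or.inl ⟨η, hη, e₀, e₁, hη₁, hη₀⟩
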